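/- arXiv:2302.08652 — 3 statements merged into one kernel-verified Lean document; each statement's English description precedes it below -/
import Mathlib

section
/- Fix integers T ≥ 1, N ≥ 1 and a real β > 0. Let ℓ_1,…,ℓ_T ∈ ℝ^N (loss vectors) and m_1,…,m_T ∈ ℝ^N (optimism vectors), and define the Optimistic Hedge weights w_t ∈ Δ_N by w_{t,i} = exp(−β(Σ_{s=1}^{t−1} ℓ_{s,i} + m_{t,i})) / Σ_{j=1}^N exp(−β(Σ_{s=1}^{t−1} ℓ_{s,j} + m_{t,j})). Then for every i ∈ {1,…,N}: Σ_{t=1}^T (Σ_{j=1}^N w_{t,j} ℓ_{t,j} − ℓ_{t,i}) ≤ (2 + ln N)/β + β Σ_{t=1}^T ‖ℓ_t − m_t‖_∞² − (1/(4β)) Σ_{t=2}^T ‖w_t − w_{t−1}‖_1². -/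
open Finset

/-- A rational lower bound on the logarithm, tight to third order at `1`. -/
lemma rational_le_log {x : ℝ} (hx : 0 < x) :
    (5 * x ^ 2 - 4 * x - 1) / (2 * x ^ 2 + 4 * x) ≤ Real.log x := by
  let h : ℝ → ℝ := fun y => Real.log y - (5 * y ^ 2 - 4 * y - 1) / (2 * y ^ 2 + 4 * y)
  have hd : ∀ y : ℝ, 0 < y → HasDerivAt h ((y - 1) ^ 3 / (y ^ 2 * (y + 2) ^ 2)) y := by
    intro y hy
    have hden : 2 * y ^ 2 + 4 * y ≠ 0 := by positivity
    have h1 : HasDerivAt (fun y : ℝ => 5 * y ^ 2 - 4 * y - 1) (10 * y - 4) y := by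
      refine ((((hasDerivAt_pow 2 y).const_mul 5).sub
        ((hasDerivAt_id y).const_mul 4)).sub_const 1).congr_deriv ?_
      push_cast
      ring
    have h2 : HasDerivAt (fun y : ℝ => 2 * y ^ 2 + 4 * y) (4 * y + 4) y := by
      refine (((hasDerivAt_pow 2 y).const_mul 2).add
        ((hasDerivAt_id y).const_mul 4)).congr_deriv ?_
      push_cast
      ring
    refine ((Real.hasDerivAt_log hy.ne').sub (h1.div h2 hden)).congr_deriv ?_
    have : y + 2 ≠ 0 := by positivity
    have h3 : 2 * y ^ 2 + 4 * y = 2 * y * (y + 2) := by ring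
    rw [h3]
    field_simp
    ring
  have h1 : h 1 = 0 := by norm_num [h]
  suffices 0 ≤ h x from sub_nonneg.mp this
  rw [← h1]
  rcases le_total 1 x with hx1 | hx1
  · refine monotoneOn_of_deriv_nonneg (convex_Ici 1)
      (fun y hy => (hd y (zero_lt_one.trans_le hy)).continuousAt.continuousWithinAt)
      (fun y hy => ?_) (fun y hy => ?_) (Set.self_mem_Ici) hx1 hx1
    · rw [interior_Ici] at hy
      exact (hd y (zero_lt_one.trans hy)).differentiableAt.differentiableWithinAt
    · rw [interior_Ici] at hy
      rw [(hd y (zero_lt_one.trans hy)).deriv]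
      have : 0 ≤ y - 1 := sub_nonneg.mpr (le_of_lt hy)
      positivity
  · refine antitoneOn_of_deriv_nonpos (convex_Ioc 0 1)
      (fun y hy => (hd y hy.1).continuousAt.continuousWithinAt)
      (fun y hy => ?_) (fun y hy => ?_) ⟨hx, hx1⟩ ⟨zero_lt_one, le_rfl⟩ hx1
    · rw [interior_Ioc] at hy
      exact (hd y hy.1).differentiableAt.differentiableWithinAt
    · rw [interior_Ioc] at hy
      rw [(hd y hy.1).deriv]
      refine div_nonpos_of_nonpos_of_nonneg ?_ (by positivity)
      exact (Odd.pow_nonpos_iff (by decide)).mpr (sub_nonpos.mpr hy.2.le)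

lemma three_mul_sq_div_le_mul_log {p q : ℝ} (hp : 0 < p) (hq : 0 < q) :
    3 * ((p - q) ^ 2 / (4 * q + 2 * p)) ≤ p * (Real.log p - Real.log q) - p + q := by
  have h := mul_le_mul_of_nonneg_left (rational_le_log (div_pos hp hq)) hp.le
  rw [Real.log_div hp.ne' hq.ne'] at h
  have he : p * ((5 * (p / q) ^ 2 - 4 * (p / q) - 1) / (2 * (p / q) ^ 2 + 4 * (p / q))) - p + q
      = 3 * ((p - q) ^ 2 / (4 * q + 2 * p)) := by
    have h1 : 4 * q + 2 * p = 2 * (p + 2 * q) := by ring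
    have h2 : 2 * (p / q) ^ 2 + 4 * (p / q) = 2 * p * (p + 2 * q) / q ^ 2 := by
      field_simp
      ring
    have h3 : p + 2 * q ≠ 0 := by positivity
    rw [h1, h2]
    field_simp
    ring
  linarith

/-- Pinsker's inequality for positive probability vectors. -/
lemma pinsker_of_pos {ι : Type*} [Fintype ι] {p q : ι → ℝ} (hp : ∀ j, 0 < p j)
    (hq : ∀ j, 0 < q j) (hp1 : ∑ j, p j = 1) (hq1 : ∑ j, q j = 1) :
    (∑ j, |p j - q j|) ^ 2 / 2 ≤ ∑ j, p j * (Real.log (p j) - Real.log (q j)) := by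
  have hcs := Finset.sq_sum_div_le_sum_sq_div Finset.univ (fun j => |p j - q j|)
    (g := fun j => 4 * q j + 2 * p j) (fun j _ => by have := hp j; have := hq j; positivity)
  have hsum : ∑ j, (4 * q j + 2 * p j) = 6 := by
    rw [Finset.sum_add_distrib, ← Finset.mul_sum, ← Finset.mul_sum, hp1, hq1]; norm_num
  have hpt := Finset.sum_le_sum fun j (_ : j ∈ Finset.univ) =>
    three_mul_sq_div_le_mul_log (hp j) (hq j)
  rw [← Finset.mul_sum, Finset.sum_add_distrib, Finset.sum_sub_distrib, hp1, hq1] at hpt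
  simp only [sq_abs] at hcs
  rw [hsum] at hcs
  linarith

lemma sum_mul_le_sum_abs_mul_norm {ι : Type*} [Fintype ι] (a b : ι → ℝ) :
    ∑ j, a j * b j ≤ (∑ j, |a j|) * ‖b‖ := by
  rw [Finset.sum_mul]
  refine Finset.sum_le_sum fun j _ => (le_abs_self _).trans ?_
  rw [abs_mul]
  exact mul_le_mul_of_nonneg_left (norm_le_pi_norm b j) (abs_nonneg _)

/-- The Gibbs distribution with log-weights `x`. -/
noncomputable def gibbs {ι : Type*} [Fintype ι] (x : ι → ℝ) (j : ι) : ℝ :=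
  Real.exp (x j) / ∑ k, Real.exp (x k)

/-- The log-partition function of the log-weights `x`. -/
noncomputable def logPartition {ι : Type*} [Fintype ι] (x : ι → ℝ) : ℝ :=
  Real.log (∑ k, Real.exp (x k))

section Gibbs

variable {ι : Type*} [Fintype ι] [Nonempty ι]

lemma sum_exp_pos (x : ι → ℝ) : 0 < ∑ k, Real.exp (x k) :=
  Finset.sum_pos (fun _ _ => Real.exp_pos _) Finset.univ_nonempty

lemma gibbs_pos (x : ι → ℝ) (j : ι) : 0 < gibbs x j :=
  div_pos (Real.exp_pos _) (sum_exp_pos x)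

lemma sum_gibbs (x : ι → ℝ) : ∑ j, gibbs x j = 1 := by
  simp only [gibbs]
  rw [← Finset.sum_div, div_self (sum_exp_pos x).ne']

lemma log_gibbs (x : ι → ℝ) (j : ι) : Real.log (gibbs x j) = x j - logPartition x := by
  rw [gibbs, Real.log_div (Real.exp_pos _).ne' (sum_exp_pos x).ne', Real.log_exp, logPartition]

lemma le_logPartition (x : ι → ℝ) (j : ι) : x j ≤ logPartition x :=
  (Real.le_log_iff_exp_le (sum_exp_pos x)).mpr <|
    Finset.single_le_sum (f := fun k => Real.exp (x k)) (fun _ _ => (Real.exp_pos _).le)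
      (Finset.mem_univ j)

lemma gibbs_pinsker (x y : ι → ℝ) :
    (∑ j, |gibbs x j - gibbs y j|) ^ 2 / 2 ≤
      ∑ j, gibbs x j * (x j - y j) - logPartition x + logPartition y := by
  refine (pinsker_of_pos (gibbs_pos x) (gibbs_pos y) (sum_gibbs x) (sum_gibbs y)).trans_eq ?_
  calc ∑ j, gibbs x j * (Real.log (gibbs x j) - Real.log (gibbs y j))
      = ∑ j, (gibbs x j * (x j - y j) + gibbs x j * (logPartition y - logPartition x)) :=
        Finset.sum_congr rfl fun j _ => by rw [log_gibbs, log_gibbs]; ring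
    _ = _ := by rw [Finset.sum_add_distrib, ← Finset.sum_mul, sum_gibbs]; ring

/-- One round of Optimistic Hedge: `L` is the past cumulative loss, `m` the optimism, `l` the
loss. -/
lemma optimistic_gibbs_step {β : ℝ} (hβ : 0 < β) (L m l : ι → ℝ) :
    β * ∑ j, gibbs (-β • (L + m)) j * l j ≤
      β ^ 2 * ‖l - m‖ ^ 2
        - (∑ j, |gibbs (-β • (L + l)) j - gibbs (-β • (L + m)) j|) ^ 2 / 2
        - (∑ j, |gibbs (-β • (L + m)) j - gibbs (-β • L) j|) ^ 2 / 2
        + logPartition (-β • L) - logPartition (-β • (L + l)) := by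
  set w := gibbs (-β • (L + m)) with hw
  set p := gibbs (-β • (L + l)) with hp
  set a := ∑ j, |p j - w j| with ha
  have h1 := gibbs_pinsker (-β • (L + l)) (-β • (L + m))
  have h2 := gibbs_pinsker (-β • (L + m)) (-β • (L + l))
  have h3 := gibbs_pinsker (-β • (L + m)) (-β • L)
  rw [← hw, ← hp] at h1 h2
  rw [← hw] at h3
  have ha' : ∑ j, |w j - p j| = a := Finset.sum_congr rfl fun j _ => abs_sub_comm _ _
  rw [ha'] at h2
  rw [← ha] at h1
  have e1 : ∑ j, p j * ((-β • (L + l)) j - (-β • (L + m)) j) = -β * ∑ j, p j * (l - m) j := by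
    rw [Finset.mul_sum]
    exact Finset.sum_congr rfl fun j _ => by simp; ring
  have e2 : ∑ j, w j * ((-β • (L + m)) j - (-β • (L + l)) j) = β * ∑ j, w j * (l - m) j := by
    rw [Finset.mul_sum]
    exact Finset.sum_congr rfl fun j _ => by simp; ring
  have e3 : ∑ j, w j * ((-β • (L + m)) j - (-β • L) j)
      = β * ∑ j, w j * (l - m) j - β * ∑ j, w j * l j := by
    rw [Finset.mul_sum, Finset.mul_sum, ← Finset.sum_sub_distrib]
    exact Finset.sum_congr rfl fun j _ => by simp; ring
  rw [e1] at h1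
  rw [e2] at h2
  rw [e3] at h3
  have hdual : ∑ j, w j * (l - m) j - ∑ j, p j * (l - m) j ≤ a * ‖l - m‖ := by
    rw [← ha', ← Finset.sum_sub_distrib]
    simpa only [sub_mul] using sum_mul_le_sum_abs_mul_norm (fun j => w j - p j) (l - m)
  have ha0 : 0 ≤ a := Finset.sum_nonneg fun _ _ => abs_nonneg _
  have hdual' := mul_le_mul_of_nonneg_left hdual hβ.le
  have hstab : a ≤ β * ‖l - m‖ := by
    by_contra! hlt
    have := norm_nonneg (l - m)
    have : 0 < a := lt_of_le_of_lt (by positivity) hlt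
    nlinarith
  have hfin : β * (a * ‖l - m‖) ≤ β ^ 2 * ‖l - m‖ ^ 2 := by
    have := mul_le_mul_of_nonneg_right hstab (mul_nonneg hβ.le (norm_nonneg (l - m)))
    linarith
  linarith

end Gibbs

lemma sq_sum_abs_sub_le {ι : Type*} [Fintype ι] (a b c : ι → ℝ) :
    (∑ j, |a j - c j|) ^ 2 ≤ 2 * (∑ j, |a j - b j|) ^ 2 + 2 * (∑ j, |b j - c j|) ^ 2 := by
  have h : ∑ j, |a j - c j| ≤ ∑ j, |a j - b j| + ∑ j, |b j - c j| := by
    rw [← Finset.sum_add_distrib]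
    exact Finset.sum_le_sum fun j _ => abs_sub_le _ _ _
  have h0 : 0 ≤ ∑ j, |a j - c j| := Finset.sum_nonneg fun _ _ => abs_nonneg _
  nlinarith [sq_nonneg (∑ j, |a j - b j| - ∑ j, |b j - c j|)]

/-- Optimistic Hedge regret bound: for loss vectors `ℓ t` and optimism vectors `m t`
in `ℝ^N`, the Optimistic Hedge weights `w t` satisfy, for every expert `i`,
`∑_{t=1}^T (⟨w_t, ℓ_t⟩ - ℓ_{t,i}) ≤ (2 + ln N)/β + β ∑ ‖ℓ_t - m_t‖_∞²
  - (1/(4β)) ∑_{t=2}^T ‖w_t - w_{t-1}‖_1²`.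
Here the norm on `Fin N → ℝ` is the sup norm. -/
theorem optimistic_hedge_regret (T N : ℕ) (hT : 1 ≤ T) (hN : 1 ≤ N)
    (β : ℝ) (hβ : 0 < β)
    (ℓ m : ℕ → Fin N → ℝ) (w : ℕ → Fin N → ℝ)
    (hw : ∀ t i, w t i =
      Real.exp (-β * ((∑ s ∈ Finset.Icc 1 (t - 1), ℓ s i) + m t i)) /
        ∑ j, Real.exp (-β * ((∑ s ∈ Finset.Icc 1 (t - 1), ℓ s j) + m t j))) :
    ∀ i : Fin N,
      ∑ t ∈ Finset.Icc 1 T, ((∑ j, w t j * ℓ t j) - ℓ t i) ≤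
        (2 + Real.log N) / β
          + β * ∑ t ∈ Finset.Icc 1 T, ‖ℓ t - m t‖ ^ 2
          - (1 / (4 * β)) * ∑ t ∈ Finset.Icc 2 T, (∑ j, |w t j - w (t - 1) j|) ^ 2 := by
  intro i
  have : Nonempty (Fin N) := ⟨i⟩
  let L : ℕ → Fin N → ℝ := fun t => ∑ s ∈ Finset.Icc 1 t, ℓ s
  have hL : ∀ t, L (t + 1) = L t + ℓ (t + 1) := fun t =>
    Finset.sum_Icc_succ_top (Nat.le_add_left 1 t) ℓ
  have hw' : ∀ t, w (t + 1) = gibbs (-β • (L t + m (t + 1))) := by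
    intro t
    funext j
    rw [hw]
    simp [gibbs, L]
  have step : ∀ t, β * ∑ j, w (t + 1) j * ℓ (t + 1) j ≤
      β ^ 2 * ‖ℓ (t + 1) - m (t + 1)‖ ^ 2
        - (∑ j, |gibbs (-β • L (t + 1)) j - w (t + 1) j|) ^ 2 / 2
        - (∑ j, |w (t + 1) j - gibbs (-β • L t) j|) ^ 2 / 2
        + logPartition (-β • L t) - logPartition (-β • L (t + 1)) := by
    intro t
    rw [hw', hL]
    exact optimistic_gibbs_step hβ (L t) (m (t + 1)) (ℓ (t + 1))
  have potential : ∀ n, 1 ≤ n → β * ∑ t ∈ Finset.Icc 1 n, ∑ j, w t j * ℓ t j ≤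
      β ^ 2 * ∑ t ∈ Finset.Icc 1 n, ‖ℓ t - m t‖ ^ 2
        - (1 / 4) * ∑ t ∈ Finset.Icc 2 n, (∑ j, |w t j - w (t - 1) j|) ^ 2
        - (∑ j, |gibbs (-β • L n) j - w n j|) ^ 2 / 2
        + logPartition (-β • L 0) - logPartition (-β • L n) := by
    intro n hn
    induction n, hn using Nat.le_induction with
    | base =>
      have h := step 0
      simp only [zero_add] at h
      simp only [Finset.Icc_self, Finset.sum_singleton]
      rw [Finset.Icc_eq_empty (by norm_num), Finset.sum_empty]
      have := sq_nonneg (∑ j, |w 1 j - gibbs (-β • L 0) j|)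
      linarith
    | succ n hn ih =>
      have h := step n
      rw [Finset.sum_Icc_succ_top (by omega), Finset.sum_Icc_succ_top (by omega),
        Finset.sum_Icc_succ_top (by omega), Nat.add_sub_cancel]
      have := sq_sum_abs_sub_le (w (n + 1)) (gibbs (-β • L n)) (w n)
      linarith
  have hpot := potential T hT
  have hL0 : logPartition (-β • L 0) = Real.log N := by simp [logPartition, L]
  have hLT := le_logPartition (-β • L T) i
  have hLTi : (-β • L T) i = -β * ∑ t ∈ Finset.Icc 1 T, ℓ t i := by simp [L]
  rw [hLTi] at hLT
  rw [hL0] at hpot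
  have := sq_nonneg (∑ j, |gibbs (-β • L T) j - w T j|)
  rw [Finset.sum_sub_distrib]
  refine le_of_mul_le_mul_left ?_ hβ
  have hR : ∀ S D : ℝ, β * ((2 + Real.log N) / β + β * S - 1 / (4 * β) * D) =
      2 + Real.log N + β ^ 2 * S - (1 / 4) * D := by
    intro S D
    field_simp
  rw [hR]
  linarith
end

section
/- Let α > 0, β > 0, γ ≥ 0 and c ∈ ℝ be reals. Then −cα/√(α+β) + √(α(1+c)² + γ) ≤ √(α+β) holds if and only if (c² − 1)αβ + (α+β)γ ≤ β². -/
/-- Auxiliary algebraic lemma for the minimax analysis: for `α, β > 0`, `γ ≥ 0`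
and any `c`, `-cα/√(α+β) + √(α(1+c)² + γ) ≤ √(α+β)` iff
`(c² - 1)αβ + (α+β)γ ≤ β²`. -/
theorem auxiliary_algebraic (α β γ c : ℝ) (hα : 0 < α) (hβ : 0 < β) (hγ : 0 ≤ γ) :
    (-(c * α) / Real.sqrt (α + β) + Real.sqrt (α * (1 + c) ^ 2 + γ) ≤
        Real.sqrt (α + β)) ↔
      (c ^ 2 - 1) * α * β + (α + β) * γ ≤ β ^ 2 := by
  have hs : 0 < α + β := add_pos hα hβ
  have hr : 0 < √(α + β) := Real.sqrt_pos.2 hs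
  have hsq : √(α + β) ^ 2 = α + β := Real.sq_sqrt hs.le
  have isolate : -(c * α) / √(α + β) + √(α * (1 + c) ^ 2 + γ) ≤ √(α + β) ↔
      √(α * (1 + c) ^ 2 + γ) ≤ (α + β + c * α) / √(α + β) := by
    have : (α + β + c * α) / √(α + β) = √(α + β) - -(c * α) / √(α + β) := by
      field_simp
      rw [hsq]
      ring
    rw [this, le_sub_iff_add_le']
  rw [isolate, Real.sqrt_le_iff, div_pow, hsq, le_div_iff₀ hs]
  constructor
  · rintro ⟨-, h⟩
    linarith
  · intro h
    refine ⟨div_nonneg ?_ hr.le, by linarith⟩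
    have hc : c ^ 2 * α ≤ α + β := by
      refine le_of_mul_le_mul_right ?_ hβ
      linarith [mul_nonneg hs.le hγ]
    have habs : |c * α| ≤ α + β := by
      refine abs_le_of_sq_le_sq ?_ hs.le
      calc (c * α) ^ 2 = c ^ 2 * α * α := by ring
        _ ≤ (α + β) * (α + β) := mul_le_mul hc (by linarith) hα.le hs.le
        _ = (α + β) ^ 2 := by ring
    linarith [neg_abs_le (c * α)]
end

section
/- Fix integers T ≥ 1, N ≥ 1 and a real B > 0, and set τ = 1/(2B²). Let ℓ_t, m_t^v, m_t^s ∈ ℝ^N for t = 1,…,T satisfy ‖ℓ_t − m_t^v‖_2 ≤ B and ‖ℓ_t − m_t^s‖_2 ≤ B for all t. Define γ_t = exp(−τ Σ_{r=1}^{t−1} ‖ℓ_r − m_r^v‖_2²) / (exp(−τ Σ_{r=1}^{t−1} ‖ℓ_r − m_r^v‖_2²) + exp(−τ Σ_{r=1}^{t−1} ‖ℓ_r − m_r^s‖_2²)) and m_t = γ_t m_t^v + (1−γ_t) m_t^s. Then Σ_{t=1}^T ‖ℓ_t − m_t‖_2² ≤ min(Σ_{t=1}^T ‖ℓ_t − m_t^v‖_2²,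 Σ_{t=1}^T ‖ℓ_t − m_t^s‖_2²) + 2B² ln 2. -/
open Finset

/-- The Gaussian `s ↦ exp (-τ s²)` is concave up to its inflection point `1 / √(2τ)`. -/
theorem concaveOn_exp_neg_mul_sq {τ B : ℝ} (hτ : 0 ≤ τ) (hτB : 2 * τ * B ^ 2 ≤ 1) :
    ConcaveOn ℝ (Set.Icc 0 B) fun s : ℝ => Real.exp (-τ * s ^ 2) := by
  have hderiv (s : ℝ) : HasDerivAt (fun s : ℝ => Real.exp (-τ * s ^ 2))
      (Real.exp (-τ * s ^ 2) * (-τ * (2 * s))) s := by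
    simpa using ((hasDerivAt_pow 2 s).const_mul (-τ)).exp
  have hderiv2 (s : ℝ) : HasDerivAt (fun s : ℝ => Real.exp (-τ * s ^ 2) * (-τ * (2 * s)))
      (Real.exp (-τ * s ^ 2) * (2 * τ * (2 * τ * s ^ 2 - 1))) s := by
    refine ((hderiv s).mul (((hasDerivAt_id' s).const_mul 2).const_mul (-τ))).congr_deriv ?_
    ring
  refine concaveOn_of_hasDerivWithinAt2_nonpos (convex_Icc 0 B) (by fun_prop)
    (fun s _ => (hderiv s).hasDerivWithinAt) (fun s _ => (hderiv2 s).hasDerivWithinAt) ?_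
  intro s hs
  have hs' := interior_subset hs
  have hsq : s ^ 2 ≤ B ^ 2 := pow_le_pow_left₀ hs'.1 hs'.2 2
  have : 2 * τ * s ^ 2 ≤ 2 * τ * B ^ 2 := by gcongr
  exact mul_nonpos_of_nonneg_of_nonpos (Real.exp_pos _).le
    (mul_nonpos_of_nonneg_of_nonpos (by positivity) (by linarith))

/-- Exp-concavity of the squared norm on the ball of radius `B`. -/
theorem concaveOn_exp_neg_mul_norm_sq {E : Type*} [SeminormedAddCommGroup E] [NormedSpace ℝ E]
    {τ B : ℝ} (hτ : 0 ≤ τ) (hτB : 2 * τ * B ^ 2 ≤ 1) :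
    ConcaveOn ℝ (Metric.closedBall (0 : E) B) fun x => Real.exp (-τ * ‖x‖ ^ 2) := by
  refine ⟨convex_closedBall 0 B, fun x hx y hy a b ha hb hab => ?_⟩
  rw [mem_closedBall_zero_iff] at hx hy
  refine ((concaveOn_exp_neg_mul_sq hτ hτB).2 ⟨norm_nonneg x, hx⟩ ⟨norm_nonneg y, hy⟩
    ha hb hab).trans ?_
  have hnorm : ‖a • x + b • y‖ ≤ a • ‖x‖ + b • ‖y‖ := by
    refine (norm_add_le _ _).trans_eq ?_
    simp [norm_smul, abs_of_nonneg, ha, hb]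
  have hsq := mul_le_mul_of_nonneg_left (pow_le_pow_left₀ (norm_nonneg _) hnorm 2) hτ
  exact Real.exp_le_exp.mpr (by linarith)

/-- If each round satisfies the mixability inequality for the normalized exponential weights,
then the total weight of the two experts is at most `2 exp (-τ ∑ d)`. -/
theorem exp_add_exp_le_two_mul_exp {τ : ℝ} {a b d : ℕ → ℝ} {n : ℕ}
    (h : ∀ t ∈ Icc 1 n,
      Real.exp (-τ * ∑ r ∈ Icc 1 (t - 1), a r) * Real.exp (-τ * a t) +
        Real.exp (-τ * ∑ r ∈ Icc 1 (t - 1), b r) * Real.exp (-τ * b t) ≤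
      (Real.exp (-τ * ∑ r ∈ Icc 1 (t - 1), a r) + Real.exp (-τ * ∑ r ∈ Icc 1 (t - 1), b r)) *
        Real.exp (-τ * d t)) :
    Real.exp (-τ * ∑ r ∈ Icc 1 n, a r) + Real.exp (-τ * ∑ r ∈ Icc 1 n, b r) ≤
      2 * Real.exp (-τ * ∑ r ∈ Icc 1 n, d r) := by
  induction n with
  | zero => norm_num
  | succ n ih =>
    have hstep := h (n + 1) (by simp)
    have hprev := ih fun t ht => h t (Icc_subset_Icc_right n.le_succ ht)
    simp only [sum_Icc_succ_top (Nat.le_add_left 1 n), mul_add, Real.exp_add]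
    rw [Nat.add_sub_cancel] at hstep
    refine hstep.trans ?_
    rw [← mul_assoc]
    gcongr

/-- Two-expert hedging for the best-of-both-worlds bound: combining optimism
vectors `mv` and `ms` (each within ℓ2-distance `B` of the losses) with
exponential weights `γ_t` at rate `τ = 1/(2B²)` achieves
`∑ ‖ℓ_t - m_t‖² ≤ min(∑ ‖ℓ_t - mv_t‖², ∑ ‖ℓ_t - ms_t‖²) + 2B² ln 2`. -/
theorem two_expert_hedging (T N : ℕ) (hT : 1 ≤ T) (hN : 1 ≤ N)
    (B : ℝ) (hB : 0 < B) (τ : ℝ) (hτ : τ = 1 / (2 * B ^ 2))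
    (ℓ mv ms : ℕ → EuclideanSpace ℝ (Fin N))
    (hv : ∀ t ∈ Finset.Icc 1 T, ‖ℓ t - mv t‖ ≤ B)
    (hs : ∀ t ∈ Finset.Icc 1 T, ‖ℓ t - ms t‖ ≤ B)
    (γ : ℕ → ℝ)
    (hγ : ∀ t, γ t =
      Real.exp (-τ * ∑ r ∈ Finset.Icc 1 (t - 1), ‖ℓ r - mv r‖ ^ 2) /
        (Real.exp (-τ * ∑ r ∈ Finset.Icc 1 (t - 1), ‖ℓ r - mv r‖ ^ 2)
          + Real.exp (-τ * ∑ r ∈ Finset.Icc 1 (t - 1), ‖ℓ r - ms r‖ ^ 2)))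
    (m : ℕ → EuclideanSpace ℝ (Fin N))
    (hm : ∀ t, m t = γ t • mv t + (1 - γ t) • ms t) :
    ∑ t ∈ Finset.Icc 1 T, ‖ℓ t - m t‖ ^ 2 ≤
      min (∑ t ∈ Finset.Icc 1 T, ‖ℓ t - mv t‖ ^ 2)
          (∑ t ∈ Finset.Icc 1 T, ‖ℓ t - ms t‖ ^ 2)
        + 2 * B ^ 2 * Real.log 2 := by
  have hτ_pos : 0 < τ := by rw [hτ]; positivity
  have hτB : 2 * τ * B ^ 2 = 1 := by rw [hτ]; field_simp
  have hweight := exp_add_exp_le_two_mul_exp (τ := τ) (n := T) (a := fun t => ‖ℓ t - mv t‖ ^ 2)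
    (b := fun t => ‖ℓ t - ms t‖ ^ 2) (d := fun t => ‖ℓ t - m t‖ ^ 2) (by
      intro t ht
      have hγt := hγ t
      set V := Real.exp (-τ * ∑ r ∈ Icc 1 (t - 1), ‖ℓ r - mv r‖ ^ 2)
      set S := Real.exp (-τ * ∑ r ∈ Icc 1 (t - 1), ‖ℓ r - ms r‖ ^ 2)
      have hV : 0 < V := Real.exp_pos _
      have hS : 0 < S := Real.exp_pos _
      have hγ' : 1 - γ t = S / (V + S) := by rw [hγt]; field_simp; ring
      have hconc := (concaveOn_exp_neg_mul_norm_sq hτ_pos.le hτB.le).2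
        (mem_closedBall_zero_iff.mpr (hv t ht)) (mem_closedBall_zero_iff.mpr (hs t ht))
        (show 0 ≤ γ t by rw [hγt]; positivity) (show 0 ≤ 1 - γ t by rw [hγ']; positivity)
        (by ring)
      have hmix : γ t • (ℓ t - mv t) + (1 - γ t) • (ℓ t - ms t) = ℓ t - m t := by
        rw [hm]; module
      simp only [hmix, smul_eq_mul] at hconc
      rw [hγ', hγt] at hconc
      calc _ = (V + S) * (V / (V + S) * Real.exp (-τ * ‖ℓ t - mv t‖ ^ 2) +
            S / (V + S) * Real.exp (-τ * ‖ℓ t - ms t‖ ^ 2)) := by field_simp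
        _ ≤ _ := by gcongr)
  have hregret (L : ℝ)
      (hL : Real.exp (-τ * L) ≤ 2 * Real.exp (-τ * ∑ t ∈ Icc 1 T, ‖ℓ t - m t‖ ^ 2)) :
      ∑ t ∈ Icc 1 T, ‖ℓ t - m t‖ ^ 2 ≤ L + 2 * B ^ 2 * Real.log 2 := by
    have hlog := Real.log_le_log (Real.exp_pos _) hL
    rw [Real.log_mul two_ne_zero (Real.exp_ne_zero _), Real.log_exp, Real.log_exp] at hlog
    refine le_of_mul_le_mul_left ?_ hτ_pos
    linear_combination hlog - Real.log 2 * hτB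
  rw [← min_add_add_right]
  exact le_min (hregret _ ((le_add_of_nonneg_right (Real.exp_pos _).le).trans hweight))
    (hregret _ ((le_add_of_nonneg_left (Real.exp_pos _).le).trans hweight))
end
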